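/- arXiv:2405.13772 — 2 statements merged into one kernel-verified Lean document; each statement's English description precedes it below -/
import Mathlib

section
/- The set of degrees of the elements of a minimal homogeneous generating set of I(G) is exactly {2} ∪ {|J| : J ∈ 𝒥(T,p) for some (T,p) ∈ 𝒯_G*}; that is, the degrees of the minimal homogeneous generators of I(G) are 2 together with the cardinalities of the minimum cardinality (T,p)-joins for (T,p) ∈ 𝒯_G*. -/
open MvPolynomial Finset

variable {n : ℕ}

/-- The monomial `x_i * x_j` attached to an edge `{i,j}`. -/
noncomputable def edgeMono (K : Type*) [Field K] (e : Sym2 (Fin n)) :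
    MvPolynomial (Fin n) K :=
  Sym2.lift ⟨fun i j => X i * X j, fun _ _ => mul_comm _ _⟩ e

/-- The map `φ : K[E_G] → K[x_1,…,x_n]`, `t_e ↦ x_i x_j` for `e = {i,j}`. -/
noncomputable def phiG (K : Type*) [Field K] (G : SimpleGraph (Fin n)) :
    MvPolynomial G.edgeSet K →ₐ[K] MvPolynomial (Fin n) K :=
  aeval (fun e => edgeMono K e.1)

/-- The Eulerian ideal `I(G) = φ⁻¹(x_i² - x_j² : i, j)`. -/
noncomputable def eulerianIdeal (K : Type*) [Field K] (G : SimpleGraph (Fin n)) :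
    Ideal (MvPolynomial G.edgeSet K) :=
  Ideal.comap (phiG K G) (Ideal.span {f | ∃ i j : Fin n, f = X i ^ 2 - X j ^ 2})

/-- `deg_J(i)`: the number of edges of `J` containing the vertex `i`. -/
def degIn (G : SimpleGraph (Fin n)) (J : Finset G.edgeSet) (i : Fin n) : ℕ :=
  (J.filter fun e => i ∈ e.val).card

/-- A set of edges is Eulerian if every vertex has even degree in it. -/
def IsEulerianSet (G : SimpleGraph (Fin n)) (C : Finset G.edgeSet) : Prop :=
  ∀ i : Fin n, Even (degIn G C i)

/-- `J` is a `T`-join. -/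
def IsTJoin (G : SimpleGraph (Fin n)) (T : Finset (Fin n)) (J : Finset G.edgeSet) : Prop :=
  ∀ i : Fin n, i ∈ T ↔ Odd (degIn G J i)

/-- `J` is a `(T,p)`-join. -/
def IsTPJoin (G : SimpleGraph (Fin n)) (T : Finset (Fin n)) (p : ZMod 2)
    (J : Finset G.edgeSet) : Prop :=
  IsTJoin G T J ∧ (J.card : ZMod 2) = p

/-- `(T,p) ∈ 𝒯_G`: there exists a `(T,p)`-join. -/
def JoinExists (G : SimpleGraph (Fin n)) (T : Finset (Fin n)) (p : ZMod 2) : Prop :=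
  ∃ J : Finset G.edgeSet, IsTPJoin G T p J

/-- `J ∈ 𝒥(T,p)`: `J` is a `(T,p)`-join of minimum cardinality. -/
def IsMinJoin (G : SimpleGraph (Fin n)) (T : Finset (Fin n)) (p : ZMod 2)
    (J : Finset G.edgeSet) : Prop :=
  IsTPJoin G T p J ∧ ∀ J' : Finset G.edgeSet, IsTPJoin G T p J' → J.card ≤ J'.card

/-- The equivalence relation `∼` on minimum cardinality `(T,p)`-joins. -/
def JoinEquiv (G : SimpleGraph (Fin n)) (T : Finset (Fin n)) (p : ZMod 2)
    (J K : Finset G.edgeSet) : Prop :=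
  ∃ (r : ℕ) (L : ℕ → Finset G.edgeSet), L 0 = J ∧ L r = K ∧
    (∀ i ≤ r, IsMinJoin G T p (L i)) ∧ ∀ i < r, (L i ∩ L (i + 1)).Nonempty

/-- `(T,p) ∈ 𝒯_G*`: there are two nonequivalent minimum cardinality `(T,p)`-joins. -/
def TGstar (G : SimpleGraph (Fin n)) (T : Finset (Fin n)) (p : ZMod 2) : Prop :=
  ∃ J K : Finset G.edgeSet, IsMinJoin G T p J ∧ IsMinJoin G T p K ∧ ¬ JoinEquiv G T p J K

/-- `t_J`, the product of the variables indexed by the edges of `J`. -/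
noncomputable def tMon (K : Type*) [Field K] (G : SimpleGraph (Fin n))
    (J : Finset G.edgeSet) : MvPolynomial G.edgeSet K :=
  ∏ e ∈ J, X e

/-- The vertex set of a set of edges. -/
def edgeVerts (G : SimpleGraph (Fin n)) (C : Finset G.edgeSet) : Finset (Fin n) :=
  Finset.univ.filter fun i => ∃ e ∈ C, i ∈ e.val

/-- `C` is the edge set of a cycle of `G`. -/
def IsCycleSet (G : SimpleGraph (Fin n)) (C : Finset G.edgeSet) : Prop :=
  ∃ (v : Fin n) (w : G.Walk v v), w.IsCycle ∧
    C.image (fun e => e.val) = w.edges.toFinset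

/-- A chord of a cycle `C`: an edge of `G` joining two nonadjacent vertices of `C`. -/
def IsChord (G : SimpleGraph (Fin n)) (C : Finset G.edgeSet) (l : G.edgeSet) : Prop :=
  l ∉ C ∧ ∀ i ∈ l.val, i ∈ edgeVerts G C

/-- An even-chord of an even cardinality Eulerian set `C`. -/
def IsEvenChord (G : SimpleGraph (Fin n)) (C : Finset G.edgeSet) (l : G.edgeSet) : Prop :=
  l ∉ C ∧ ∃ C₁ C₂ : Finset G.edgeSet,
    IsEulerianSet G C₁ ∧ Even C₁.card ∧ IsEulerianSet G C₂ ∧ Even C₂.card ∧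
    C₁ ∩ C₂ = {l} ∧ C = symmDiff C₁ C₂

/-- `S` is a minimal homogeneous generating set of the ideal `I`. -/
def IsMinimalHomGenSet {σ K : Type*} [Field K] (S : Set (MvPolynomial σ K))
    (I : Ideal (MvPolynomial σ K)) : Prop :=
  (∀ f ∈ S, ∃ d : ℕ, f.IsHomogeneous d) ∧ Ideal.span S = I ∧
    ∀ f ∈ S, Ideal.span (S \ {f}) ≠ I


namespace MvPolynomial

variable {σ K : Type*} [Field K]

/-- The linear map collecting the coefficients of the monomials in each fibre of `c`. -/
noncomputable def classMap {A : Type*} (c : (σ →₀ ℕ) → A) :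
    MvPolynomial σ K →ₗ[K] (A →₀ K) :=
  (basisMonomials σ K).constr K fun α => Finsupp.single (c α) 1

@[simp]
lemma classMap_monomial {A : Type*} (c : (σ →₀ ℕ) → A) (α : σ →₀ ℕ) :
    classMap c (monomial α (1 : K)) = Finsupp.single (c α) 1 := by
  have := (basisMonomials σ K).constr_basis K (fun α => Finsupp.single (c α) (1 : K)) α
  simpa [classMap] using this

lemma linearMap_ext_monomial {M : Type*} [AddCommMonoid M] [Module K M]
    {f g : MvPolynomial σ K →ₗ[K] M} (h : ∀ α, f (monomial α 1) = g (monomial α 1)) : f = g :=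
  (basisMonomials σ K).ext fun α => by simpa using h α

/-- A polynomial whose fibrewise coefficient sums vanish lies in every ideal containing the
differences of monomials in the fibres meeting its support. -/
lemma mem_of_classMap_eq_zero {A : Type*} (c : (σ →₀ ℕ) → A) (I : Ideal (MvPolynomial σ K))
    {f : MvPolynomial σ K} (h0 : classMap c f = 0)
    (h : ∀ α ∈ f.support, ∀ β, c β = c α → monomial α (1 : K) - monomial β 1 ∈ I) : f ∈ I := by
  let s : A → (σ →₀ ℕ) := Function.invFun c
  have hs : ∀ α, c (s (c α)) = c α := fun α => Function.invFun_eq ⟨α, rfl⟩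
  let L : (A →₀ K) →ₗ[K] MvPolynomial σ K :=
    Finsupp.linearCombination K fun a => monomial (s a) 1
  have hf : f = ∑ α ∈ f.support, coeff α f • monomial α (1 : K) := by
    conv_lhs => rw [f.as_sum]
    simp [smul_monomial]
  have hL : L (classMap c f) = ∑ α ∈ f.support, coeff α f • monomial (s (c α)) (1 : K) := by
    conv_lhs => rw [hf]
    simp only [map_sum, map_smul, classMap_monomial]
    simp [L]
  have : f = ∑ α ∈ f.support,
      coeff α f • (monomial α (1 : K) - monomial (s (c α)) 1) := by
    simp only [smul_sub, Finset.sum_sub_distrib]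
    rw [← hL, h0, ← hf]
    simp
  rw [this]
  refine I.sum_mem fun α hα => ?_
  rw [smul_eq_C_mul]
  exact I.mul_mem_left _ (h α hα _ (hs α))

/-- A linear map vanishing on all monomial multiples of `S` vanishes on the ideal spanned
by `S`. -/
lemma map_eq_zero_of_mem_span {M : Type*} [AddCommMonoid M] [Module K M]
    (ψ : MvPolynomial σ K →ₗ[K] M) {S : Set (MvPolynomial σ K)}
    (h : ∀ s ∈ S, ∀ γ, ψ (monomial γ 1 * s) = 0) {x : MvPolynomial σ K}
    (hx : x ∈ Ideal.span S) : ψ x = 0 := by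
  have key : ∀ γ, ψ (monomial γ 1 * x) = 0 := by
    refine Submodule.span_induction (p := fun x _ => ∀ γ, ψ (monomial γ 1 * x) = 0)
      h (by simp) ?_ ?_ hx
    · intro x y _ _ hx hy γ
      rw [mul_add, map_add, hx, hy, add_zero]
    · intro a x _ hx γ
      induction a using MvPolynomial.induction_on' with
      | monomial u r =>
        have : monomial γ (1 : K) * (monomial u r • x) = r • (monomial (γ + u) 1 * x) := by
          rw [smul_eq_mul, ← mul_assoc, monomial_mul, ← smul_mul_assoc, smul_monomial]
          simp
        rw [this, map_smul, hx, smul_zero]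
      | add p q hp hq => rw [add_smul, mul_add, map_add, hp, hq, add_zero]
  simpa using key 0

lemma homogeneousComponent_monomial_mul (d : ℕ) (u : σ →₀ ℕ) (r : K) (x : MvPolynomial σ K) :
    homogeneousComponent d (monomial u r * x) =
      if u.degree ≤ d then monomial u r * homogeneousComponent (d - u.degree) x else 0 := by
  ext m
  rw [coeff_homogeneousComponent]
  have hadd : ∀ h : u ≤ m, m.degree = u.degree + (m - u).degree := fun h => by
    conv_lhs => rw [← add_tsub_cancel_of_le h]
    rw [map_add]
  split_ifs with h1 h2 h2
  · rw [coeff_monomial_mul', coeff_monomial_mul', coeff_homogeneousComponent]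
    by_cases hu : u ≤ m
    · have := hadd hu
      rw [if_pos hu, if_pos hu, if_pos (by omega)]
    · rw [if_neg hu, if_neg hu]
  · rw [coeff_monomial_mul']
    rw [if_neg, coeff_zero]
    intro hu
    have := hadd hu
    omega
  · rw [coeff_monomial_mul', coeff_homogeneousComponent]
    by_cases hu : u ≤ m
    · have := hadd hu
      rw [if_pos hu, if_neg (by omega), mul_zero]
    · rw [if_neg hu]
  · rw [coeff_zero]

lemma homogeneousComponent_mem_span {S : Set (MvPolynomial σ K)}
    (hS : ∀ f ∈ S, ∃ d : ℕ, f.IsHomogeneous d) {x : MvPolynomial σ K} (hx : x ∈ Ideal.span S)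
    (d : ℕ) : homogeneousComponent d x ∈ Ideal.span {s ∈ S | s.totalDegree ≤ d} := by
  revert d
  refine Submodule.span_induction
    (p := fun x _ => ∀ d, homogeneousComponent d x ∈ Ideal.span {s ∈ S | s.totalDegree ≤ d})
    ?_ (by simp) ?_ ?_ hx
  · intro s hs d
    obtain ⟨e, he⟩ := hS s hs
    rw [homogeneousComponent_of_mem ((mem_homogeneousSubmodule _ _).2 he)]
    split_ifs with h
    · subst h
      exact Ideal.subset_span ⟨hs, he.totalDegree_le⟩
    · exact zero_mem _
  · intro x y _ _ hx hy d
    rw [map_add]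
    exact add_mem (hx d) (hy d)
  · intro a x _ hx d
    induction a using MvPolynomial.induction_on' with
    | monomial u r =>
      rw [smul_eq_mul, homogeneousComponent_monomial_mul]
      split_ifs
      · refine Ideal.mul_mem_left _ _ (Ideal.span_mono ?_ (hx (d - u.degree)))
        exact fun s hs => ⟨hs.1, hs.2.trans (Nat.sub_le _ _)⟩
      · exact zero_mem _
    | add p q hp hq => rw [add_smul, map_add]; exact add_mem hp hq

/-- The ideal generated by the homogeneous elements of `I` of degree less than `d`. -/
noncomputable def lowIdeal (I : Ideal (MvPolynomial σ K)) (d : ℕ) : Ideal (MvPolynomial σ K) :=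
  Ideal.span {g | g ∈ I ∧ ∃ e < d, g.IsHomogeneous e}

/-- Graded Nakayama: the degrees of minimal generators are the degrees in which `I` is not
generated from lower degree. -/
lemma mem_totalDegree_image_iff {S : Set (MvPolynomial σ K)} {I : Ideal (MvPolynomial σ K)}
    (hS : IsMinimalHomGenSet S I) (d : ℕ) :
    d ∈ (fun f : MvPolynomial σ K => f.totalDegree) '' S ↔
      ∃ f ∈ I, f.IsHomogeneous d ∧ f ∉ lowIdeal I d := by
  obtain ⟨hhom, hspan, hmin⟩ := hS
  have hle : ∀ f ∈ I, ∀ e, f.IsHomogeneous e → f ∈ Ideal.span {s ∈ S | s.totalDegree ≤ e} := by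
    intro f hf e he
    have := homogeneousComponent_mem_span hhom (hspan ▸ hf) e
    rwa [homogeneousComponent_eq_self he] at this
  constructor
  · rintro ⟨f, hf, rfl⟩
    have hfI : f ∈ I := hspan ▸ Ideal.subset_span hf
    have hf0 : f ≠ 0 := by
      rintro rfl
      exact hmin 0 hf (by rw [Ideal.span_sdiff_singleton_zero, hspan])
    obtain ⟨d, hd⟩ := hhom f hf
    have hdeg : f.totalDegree = d := hd.totalDegree hf0
    refine ⟨f, hfI, by simpa only [hdeg] using hd, fun hlow => hmin f hf ?_⟩
    have h1 : lowIdeal I f.totalDegree ≤ Ideal.span (S \ {f}) := by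
      refine Ideal.span_le.2 ?_
      rintro g ⟨hg, e, he, hge⟩
      refine Ideal.span_mono ?_ (hle g hg e hge)
      rintro s ⟨hs, hse⟩
      refine ⟨hs, ?_⟩
      rintro rfl
      omega
    refine le_antisymm (hspan ▸ Ideal.span_mono Set.sdiff_subset) ?_
    rw [← hspan, Ideal.span_le]
    intro s hs
    by_cases hsf : s = f
    · exact hsf ▸ h1 hlow
    · exact Ideal.subset_span ⟨hs, hsf⟩
  · rintro ⟨f, hfI, hfd, hlow⟩
    by_contra hno
    refine hlow (Ideal.span_mono ?_ (hle f hfI d hfd))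
    rintro s ⟨hs, hsd⟩
    obtain ⟨e, he⟩ := hhom s hs
    refine ⟨hspan ▸ Ideal.subset_span hs, ?_⟩
    have hne : s.totalDegree ≠ d := fun h => hno ⟨s, hs, h⟩
    by_cases hs0 : s = 0
    · refine ⟨0, ?_, hs0 ▸ isHomogeneous_zero _ _ _⟩
      subst hs0
      simp at hne
      omega
    · exact ⟨e, by rw [← he.totalDegree hs0]; omega, he⟩

end MvPolynomial

section ParityClasses

variable {K : Type*} [Field K] {G : SimpleGraph (Fin n)}

/-- The total degree and the vector of parities of an exponent. -/
noncomputable def parityClass (a : Fin n →₀ ℕ) : ℕ × (Fin n → ZMod 2) :=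
  (a.degree, fun i => (a i : ZMod 2))

lemma parityClass_add (a b : Fin n →₀ ℕ) :
    parityClass (a + b) = parityClass a + parityClass b := by
  ext <;> simp [parityClass]

lemma monomial_sub_monomial_mem_of_parityClass_eq {a b : Fin n →₀ ℕ}
    (h : parityClass a = parityClass b) :
    monomial a (1 : K) - monomial b 1 ∈
      Ideal.span {f : MvPolynomial (Fin n) K | ∃ i j : Fin n, f = X i ^ 2 - X j ^ 2} := by
  set I := Ideal.span {f : MvPolynomial (Fin n) K | ∃ i j : Fin n, f = X i ^ 2 - X j ^ 2}
  obtain ⟨hdeg, hpar⟩ := Prod.ext_iff.1 h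
  rcases isEmpty_or_nonempty (Fin n) with hn | ⟨⟨z⟩⟩
  · rw [Subsingleton.elim a b, sub_self]
    exact zero_mem _
  · have hsq : ∀ i, Ideal.Quotient.mk I (X i) ^ 2 = Ideal.Quotient.mk I (X z) ^ 2 := by
      intro i
      rw [← map_pow, ← map_pow]
      exact Ideal.Quotient.eq.2 (Ideal.subset_span ⟨i, z, rfl⟩)
    have key : ∀ a : Fin n →₀ ℕ, Ideal.Quotient.mk I (monomial a (1 : K)) =
        (∏ i, Ideal.Quotient.mk I (X i) ^ (a i % 2)) *
          (Ideal.Quotient.mk I (X z) ^ 2) ^ ∑ i, a i / 2 := by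
      intro a
      rw [monomial_eq, Finsupp.prod_fintype _ _ (fun i => pow_zero _), C_1, one_mul, map_prod,
        ← Finset.prod_pow_eq_pow_sum, ← Finset.prod_mul_distrib]
      refine Finset.prod_congr rfl fun i _ => ?_
      rw [map_pow, ← hsq i, ← pow_mul, ← pow_add, Nat.mod_add_div]
    have hmod : ∀ i, a i % 2 = b i % 2 := fun i =>
      (ZMod.natCast_eq_natCast_iff' _ _ 2).1 (congrFun hpar i)
    have hsum : ∀ a : Fin n →₀ ℕ, a.degree = ∑ i, a i % 2 + 2 * ∑ i, a i / 2 := by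
      intro a
      rw [Finsupp.degree_eq_sum, Finset.mul_sum, ← Finset.sum_add_distrib]
      exact Finset.sum_congr rfl fun i _ => (Nat.mod_add_div _ _).symm
    refine Ideal.Quotient.eq.1 ?_
    have h1 := hsum a
    have h2 := hsum b
    have h3 : ∑ i, a i % 2 = ∑ i, b i % 2 := Finset.sum_congr rfl fun i _ => hmod i
    have hdeg' : a.degree = b.degree := hdeg
    rw [key, key, show ∑ i, a i / 2 = ∑ i, b i / 2 by omega]
    simp only [hmod]

lemma mem_span_sq_sub_sq_iff (f : MvPolynomial (Fin n) K) :
    f ∈ Ideal.span {f : MvPolynomial (Fin n) K | ∃ i j : Fin n, f = X i ^ 2 - X j ^ 2} ↔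
      classMap parityClass f = 0 := by
  refine ⟨fun h => map_eq_zero_of_mem_span _ ?_ h, fun h => mem_of_classMap_eq_zero _ _ h
    fun α _ β hβ => monomial_sub_monomial_mem_of_parityClass_eq hβ.symm⟩
  rintro _ ⟨i, j, rfl⟩ γ
  rw [X_pow_eq_monomial, X_pow_eq_monomial, mul_sub, monomial_mul, monomial_mul, mul_one,
    map_sub, classMap_monomial, classMap_monomial, parityClass_add, parityClass_add, sub_eq_zero]
  congr 2
  ext k
  · simp [parityClass]
  · have h2 : (2 : ZMod 2) = 0 := rfl
    simp only [parityClass, Finsupp.single_apply]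
    split_ifs <;> simp [h2]

/-- The exponent of the monomial attached to an edge. -/
noncomputable def edgeExp (e : Sym2 (Fin n)) : Fin n →₀ ℕ :=
  Finsupp.equivFunOnFinite.symm fun i => if i ∈ e then 1 else 0

lemma edgeExp_apply (e : Sym2 (Fin n)) (i : Fin n) :
    edgeExp e i = if i ∈ e then 1 else 0 := rfl

lemma edgeExp_mk {i j : Fin n} (h : i ≠ j) :
    edgeExp s(i, j) = Finsupp.single i 1 + Finsupp.single j 1 := by
  ext k
  simp only [edgeExp_apply, Sym2.mem_iff, Finsupp.add_apply, Finsupp.single_apply]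
  split_ifs <;> grind

lemma edgeMono_eq (e : G.edgeSet) : edgeMono K e.1 = monomial (edgeExp e.1) 1 := by
  obtain ⟨e, he⟩ := e
  induction e using Sym2.ind with
  | _ i j =>
    rw [edgeExp_mk (G.ne_of_adj he)]
    simp [edgeMono, X, monomial_mul]

lemma degree_edgeExp (e : G.edgeSet) : (edgeExp e.1).degree = 2 := by
  obtain ⟨e, he⟩ := e
  induction e using Sym2.ind with
  | _ i j => simp [edgeExp_mk (G.ne_of_adj he)]

/-- The exponent of the image under `φ` of a monomial in the edge variables. -/
noncomputable def vertexExp (G : SimpleGraph (Fin n)) :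
    (G.edgeSet →₀ ℕ) →ₗ[ℕ] (Fin n →₀ ℕ) :=
  Finsupp.linearCombination ℕ fun e => edgeExp e.1

lemma vertexExp_single (e : G.edgeSet) (k : ℕ) :
    vertexExp G (Finsupp.single e k) = k • edgeExp e.1 := by
  simp [vertexExp]

lemma phiG_monomial (α : G.edgeSet →₀ ℕ) :
    phiG K G (monomial α 1) = monomial (vertexExp G α) 1 := by
  induction α using Finsupp.induction_linear with
  | zero => simp
  | add α β hα hβ =>
    rw [← mul_one (1 : K), ← monomial_mul, map_mul, hα, hβ, map_add, monomial_mul]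
  | single e k =>
    rw [← X_pow_eq_monomial, map_pow, phiG, aeval_X, edgeMono_eq, monomial_pow, one_pow,
      vertexExp_single]

lemma degree_vertexExp (α : G.edgeSet →₀ ℕ) : (vertexExp G α).degree = 2 * α.degree := by
  induction α using Finsupp.induction_linear with
  | zero => simp
  | add α β hα hβ => rw [map_add, map_add, map_add, hα, hβ, mul_add]
  | single e k =>
    rw [vertexExp_single, map_nsmul, degree_edgeExp, Finsupp.degree_single]
    simp [mul_comm]

/-- The class of an exponent in the edge variables: congruence modulo the Eulerian ideal. -/
noncomputable def edgeClass (α : G.edgeSet →₀ ℕ) : ℕ × (Fin n → ZMod 2) :=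
  parityClass (vertexExp G α)

lemma edgeClass_add (α β : G.edgeSet →₀ ℕ) :
    edgeClass (α + β) = edgeClass α + edgeClass β := by
  rw [edgeClass, map_add, parityClass_add, edgeClass, edgeClass]

lemma mem_eulerianIdeal_iff (f : MvPolynomial G.edgeSet K) :
    f ∈ eulerianIdeal K G ↔ classMap edgeClass f = 0 := by
  rw [eulerianIdeal, Ideal.mem_comap, mem_span_sq_sub_sq_iff]
  have : (classMap parityClass).comp (phiG K G).toLinearMap = classMap (K := K) edgeClass :=
    linearMap_ext_monomial fun α => by simp [phiG_monomial, edgeClass]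
  rw [← this]
  rfl

lemma monomial_sub_monomial_mem_eulerianIdeal {α β : G.edgeSet →₀ ℕ}
    (h : edgeClass α = edgeClass β) :
    monomial α (1 : K) - monomial β 1 ∈ eulerianIdeal K G := by
  rw [mem_eulerianIdeal_iff, map_sub, classMap_monomial, classMap_monomial, h, sub_self]

/-- The set of edges with odd exponent. -/
def oddSupport (α : G.edgeSet →₀ ℕ) : Finset G.edgeSet := α.support.filter fun e => Odd (α e)

lemma mem_oddSupport {α : G.edgeSet →₀ ℕ} {e : G.edgeSet} : e ∈ oddSupport α ↔ Odd (α e) := by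
  simp only [oddSupport, Finset.mem_filter, Finsupp.mem_support_iff, and_iff_right_iff_imp]
  intro h h0
  simp [h0] at h

/-- The exponent of the squarefree monomial attached to a set of edges. -/
noncomputable def setExp (J : Finset G.edgeSet) : G.edgeSet →₀ ℕ :=
  Finsupp.indicator J fun _ _ => 1

lemma setExp_apply (J : Finset G.edgeSet) (e : G.edgeSet) :
    setExp J e = if e ∈ J then 1 else 0 := by
  simp [setExp, Finsupp.indicator_apply]

lemma oddSupport_setExp (J : Finset G.edgeSet) : oddSupport (setExp J) = J := by
  ext e
  rw [mem_oddSupport, setExp_apply]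
  split_ifs with h <;> simp [h]

lemma degree_eq_card_add (α : G.edgeSet →₀ ℕ) :
    α.degree = (oddSupport α).card + 2 * ∑ e ∈ α.support, α e / 2 := by
  rw [oddSupport, Finset.card_filter, Finset.mul_sum, ← Finset.sum_add_distrib,
    Finsupp.degree_apply]
  refine Finset.sum_congr rfl fun e _ => ?_
  split_ifs with h
  · have := Nat.odd_iff.1 h
    omega
  · have := Nat.even_iff.1 (Nat.not_odd_iff_even.1 h)
    omega

lemma degree_eq_card_iff (α : G.edgeSet →₀ ℕ) :
    α.degree = (oddSupport α).card ↔ ∀ e, α e ≤ 1 := by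
  rw [degree_eq_card_add]
  simp only [Nat.add_eq_left, mul_eq_zero, OfNat.ofNat_ne_zero, false_or,
    Finset.sum_eq_zero_iff, Finsupp.mem_support_iff]
  refine forall_congr' fun e => ⟨fun h => ?_, fun h _ => by omega⟩
  by_cases h0 : α e = 0
  · omega
  · have := h h0
    omega

lemma eq_setExp_oddSupport {α : G.edgeSet →₀ ℕ} (h : ∀ e, α e ≤ 1) :
    setExp (oddSupport α) = α := by
  ext e
  rw [setExp_apply]
  have := h e
  split_ifs with ho <;> rw [mem_oddSupport, Nat.odd_iff] at ho <;> omega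

lemma degree_setExp (J : Finset G.edgeSet) : (setExp J).degree = J.card := by
  have := (degree_eq_card_iff (setExp J)).2 fun e => by
    rw [setExp_apply]; split_ifs <;> omega
  rwa [oddSupport_setExp] at this

lemma vertexExp_apply_cast (α : G.edgeSet →₀ ℕ) (i : Fin n) :
    (vertexExp G α i : ZMod 2) = degIn G (oddSupport α) i := by
  rw [vertexExp, Finsupp.linearCombination_apply, Finsupp.sum_apply, Finsupp.sum, degIn,
    Finset.card_filter, oddSupport, Finset.sum_filter]
  push_cast
  refine Finset.sum_congr rfl fun e _ => ?_
  rw [Pi.smul_apply, edgeExp_apply]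
  split_ifs with h1 h2 h2 <;> simp
  · exact (ZMod.natCast_eq_one_iff_odd).2 h2
  · exact (ZMod.natCast_eq_zero_iff_even).2 (Nat.not_odd_iff_even.1 h2)

lemma edgeClass_eq_iff {α β : G.edgeSet →₀ ℕ} :
    edgeClass α = edgeClass β ↔ α.degree = β.degree ∧
      ∀ i, (Odd (degIn G (oddSupport α) i) ↔ Odd (degIn G (oddSupport β) i)) := by
  rw [edgeClass, edgeClass, parityClass, parityClass, Prod.mk.injEq, funext_iff,
    degree_vertexExp, degree_vertexExp]
  refine and_congr (by omega) (forall_congr' fun i => ?_)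
  rw [vertexExp_apply_cast, vertexExp_apply_cast, ZMod.natCast_eq_natCast_iff', Nat.odd_iff,
    Nat.odd_iff]
  omega

lemma isTPJoin_oddSupport_of_edgeClass_eq {α β : G.edgeSet →₀ ℕ} (h : edgeClass α = edgeClass β)
    {T : Finset (Fin n)} {p : ZMod 2} (hα : IsTPJoin G T p (oddSupport α)) :
    IsTPJoin G T p (oddSupport β) := by
  obtain ⟨hdeg, hodd⟩ := edgeClass_eq_iff.1 h
  refine ⟨fun i => (hα.1 i).trans (hodd i), hα.2 ▸ ?_⟩
  have h1 := degree_eq_card_add α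
  have h2 := degree_eq_card_add β
  rw [ZMod.natCast_eq_natCast_iff']
  omega

lemma edgeClass_setExp_eq {T : Finset (Fin n)} {p : ZMod 2} {J L : Finset G.edgeSet}
    (hJ : IsTPJoin G T p J) (hL : IsTPJoin G T p L) (h : J.card = L.card) :
    edgeClass (setExp J) = edgeClass (setExp L) := by
  rw [edgeClass_eq_iff, degree_setExp, degree_setExp, oddSupport_setExp, oddSupport_setExp]
  exact ⟨h, fun i => (hJ.1 i).symm.trans (hL.1 i)⟩

lemma IsMinJoin.card_eq {T : Finset (Fin n)} {p : ZMod 2} {J L : Finset G.edgeSet}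
    (hJ : IsMinJoin G T p J) (hL : IsMinJoin G T p L) : J.card = L.card :=
  le_antisymm (hJ.2 _ hL.1) (hL.2 _ hJ.1)

/-- An exponent in the class of a minimum cardinality join is squarefree, and is itself given by
a minimum cardinality join. -/
lemma isMinJoin_of_edgeClass_eq {T : Finset (Fin n)} {p : ZMod 2} {α β : G.edgeSet →₀ ℕ}
    (hα : ∀ e, α e ≤ 1) (hmin : IsMinJoin G T p (oddSupport α)) (h : edgeClass α = edgeClass β) :
    (∀ e, β e ≤ 1) ∧ IsMinJoin G T p (oddSupport β) := by
  have hβ := isTPJoin_oddSupport_of_edgeClass_eq h hmin.1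
  have h1 := hmin.2 _ hβ
  have h2 := (degree_eq_card_iff α).2 hα
  have h3 := degree_eq_card_add β
  have h4 := (edgeClass_eq_iff.1 h).1
  refine ⟨(degree_eq_card_iff β).1 (by omega), hβ, fun J' hJ' => ?_⟩
  have := hmin.2 _ hJ'
  omega

lemma eq_of_edgeClass_eq_of_degree_le_one {α β : G.edgeSet →₀ ℕ} (h : edgeClass α = edgeClass β)
    (hd : α.degree ≤ 1) : α = β := by
  have hdeg := (edgeClass_eq_iff.1 h).1
  rcases Nat.le_one_iff_eq_zero_or_eq_one.1 hd with h0 | h1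
  · rw [(Finsupp.degree_eq_zero_iff α).1 h0, (Finsupp.degree_eq_zero_iff β).1 (hdeg ▸ h0)]
  · obtain ⟨f, rfl⟩ := (Finsupp.sum_eq_one_iff β).1 (hdeg.symm.trans h1)
    obtain ⟨e, rfl⟩ := (Finsupp.sum_eq_one_iff α).1 h1
    have : e = f := by
      refine Subtype.ext (Sym2.ext fun i => ?_)
      have := congrFun (Prod.ext_iff.1 h).2 i
      simp only [edgeClass, parityClass, vertexExp_single, one_smul, edgeExp_apply] at this
      split_ifs at this <;> simp_all
    rw [this]

lemma edgeClass_single_two (e : G.edgeSet) : edgeClass (Finsupp.single e 2) = (4, 0) := by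
  have h2 : (2 : ZMod 2) = 0 := rfl
  refine Prod.ext ?_ (funext fun i => ?_)
  · simp [edgeClass, parityClass, degree_vertexExp]
  · simp [edgeClass, parityClass, vertexExp_single, h2]

lemma monomial_sub_monomial_mem_lowIdeal {α β : G.edgeSet →₀ ℕ} (h : edgeClass α = edgeClass β)
    {e : G.edgeSet} (hα : α e ≠ 0) (hβ : β e ≠ 0) :
    monomial α (1 : K) - monomial β 1 ∈ lowIdeal (eulerianIdeal K G) α.degree := by
  have hsplit : ∀ α : G.edgeSet →₀ ℕ, α e ≠ 0 → ∃ α', α = Finsupp.single e 1 + α' :=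
    fun α hα => ⟨α - Finsupp.single e 1, (add_tsub_cancel_of_le
      (Finsupp.single_le_iff.2 (Nat.one_le_iff_ne_zero.2 hα))).symm⟩
  obtain ⟨α', rfl⟩ := hsplit α hα
  obtain ⟨β', rfl⟩ := hsplit β hβ
  rw [edgeClass_add, edgeClass_add] at h
  have h' := add_left_cancel h
  have hfac : ∀ γ : G.edgeSet →₀ ℕ, monomial (Finsupp.single e 1 + γ) (1 : K) =
      monomial (Finsupp.single e 1) 1 * monomial γ 1 := fun γ => by
    rw [monomial_mul, one_mul]
  rw [hfac, hfac, ← mul_sub]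
  refine Ideal.mul_mem_left _ _ (Ideal.subset_span
    ⟨monomial_sub_monomial_mem_eulerianIdeal h', α'.degree, ?_, ?_⟩)
  · rw [map_add, Finsupp.degree_single]
    omega
  · exact (isHomogeneous_monomial _ rfl).sub
      (isHomogeneous_monomial _ (edgeClass_eq_iff.1 h').1.symm)

/-- If a class of degree at least three has a non-squarefree monomial, its differences are
generated in lower degree. -/
lemma monomial_sub_monomial_mem_lowIdeal_of_not_squarefree {α γ : G.edgeSet →₀ ℕ}
    (h : edgeClass α = edgeClass γ) (hd : 3 ≤ α.degree) {e : G.edgeSet} (he : 2 ≤ γ e) :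
    monomial α (1 : K) - monomial γ 1 ∈ lowIdeal (eulerianIdeal K G) α.degree := by
  obtain ⟨γ', rfl⟩ : ∃ γ', γ = Finsupp.single e 2 + γ' :=
    ⟨γ - Finsupp.single e 2, (add_tsub_cancel_of_le (Finsupp.single_le_iff.2 he)).symm⟩
  have hdeg := (edgeClass_eq_iff.1 h).1
  rw [map_add, Finsupp.degree_single] at hdeg
  obtain ⟨f, hf⟩ : ∃ f, α f ≠ 0 := by
    by_contra! h0
    have : α = 0 := Finsupp.ext h0
    simp [this] at hd
  obtain ⟨g, hg⟩ : ∃ g, γ' g ≠ 0 := by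
    by_contra! h0
    have : γ' = 0 := Finsupp.ext h0
    simp [this] at hdeg
    omega
  have hfe : edgeClass α = edgeClass (Finsupp.single f 2 + γ') := by
    rw [h, edgeClass_add, edgeClass_add, edgeClass_single_two, edgeClass_single_two]
  have h1 := monomial_sub_monomial_mem_lowIdeal (K := K) hfe hf (by simp)
  have h2 := monomial_sub_monomial_mem_lowIdeal (K := K) (hfe.symm.trans h) (e := g)
    (by simp [hg]) (by simp [hg])
  rw [← (edgeClass_eq_iff.1 hfe).1] at h2
  have := add_mem h1 h2
  rwa [sub_add_sub_cancel] at this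

lemma JoinEquiv.monomial_sub_mem_lowIdeal {T : Finset (Fin n)} {p : ZMod 2}
    {J L : Finset G.edgeSet} (h : JoinEquiv G T p J L) :
    monomial (setExp J) (1 : K) - monomial (setExp L) 1 ∈
      lowIdeal (eulerianIdeal K G) J.card := by
  obtain ⟨r, F, rfl, rfl, hmin, hint⟩ := h
  suffices ∀ i ≤ r, monomial (setExp (F 0)) (1 : K) - monomial (setExp (F i)) 1 ∈
      lowIdeal (eulerianIdeal K G) (F 0).card from this r le_rfl
  intro i hi
  induction i with
  | zero => rw [sub_self]; exact zero_mem _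
  | succ i ih =>
    have hi0 := hmin i (by omega)
    have hi1 := hmin (i + 1) hi
    obtain ⟨e, he⟩ := hint i (by omega)
    rw [Finset.mem_inter] at he
    have h1 := monomial_sub_monomial_mem_lowIdeal (K := K)
      (edgeClass_setExp_eq hi0.1 hi1.1 (hi0.card_eq hi1)) (e := e)
      (by simp [setExp_apply, he.1]) (by simp [setExp_apply, he.2])
    rw [degree_setExp, hi0.card_eq (hmin 0 (by omega))] at h1
    have := add_mem (ih (by omega)) h1
    rwa [sub_add_sub_cancel] at this

lemma JoinEquiv.step {T : Finset (Fin n)} {p : ZMod 2} {J L M : Finset G.edgeSet}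
    (h : JoinEquiv G T p J L) (hM : IsMinJoin G T p M) (hLM : (L ∩ M).Nonempty) :
    JoinEquiv G T p J M := by
  obtain ⟨r, F, h0, rfl, hmin, hint⟩ := h
  refine ⟨r + 1, fun i => if i ≤ r then F i else M, by simpa using h0, by simp, ?_, ?_⟩
  · intro i _
    dsimp only
    split_ifs with hi
    exacts [hmin i hi, hM]
  · intro i hi
    dsimp only
    rw [if_pos (by omega)]
    split_ifs with hi'
    · exact hint i (by omega)
    · obtain rfl : i = r := by omega
      exact hLM

lemma JoinEquiv.isMinJoin {T : Finset (Fin n)} {p : ZMod 2} {J L : Finset G.edgeSet}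
    (h : JoinEquiv G T p J L) : IsMinJoin G T p L := by
  obtain ⟨r, F, -, rfl, hmin, -⟩ := h
  exact hmin r le_rfl

lemma monomial_sub_monomial_notMem_lowIdeal {T : Finset (Fin n)} {p : ZMod 2}
    {J L : Finset G.edgeSet} (hJ : IsMinJoin G T p J) (hJL : ¬ JoinEquiv G T p J L) :
    monomial (setExp J) (1 : K) - monomial (setExp L) 1 ∉
      lowIdeal (eulerianIdeal K G) J.card := by
  classical
  -- The functional summing the coefficients over the joins equivalent to `J`.
  let A : Set (G.edgeSet →₀ ℕ) := {α | (∀ e, α e ≤ 1) ∧ JoinEquiv G T p J (oddSupport α)}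
  let ψ : MvPolynomial G.edgeSet K →ₗ[K] K :=
    (Finsupp.lapply True).comp (classMap fun α => α ∈ A)
  have hψ : ∀ α, ψ (monomial α 1) = if α ∈ A then 1 else 0 := fun α => by
    simp [ψ, Finsupp.single_apply]
  have hdeg : ∀ α ∈ A, α.degree = J.card := fun α hα => by
    rw [(degree_eq_card_iff α).2 hα.1, hJ.card_eq hα.2.isMinJoin]
  have hstep : ∀ γ α β : G.edgeSet →₀ ℕ, γ ≠ 0 → edgeClass α = edgeClass β →
      γ + α ∈ A → γ + β ∈ A := by
    intro γ α β hγ h hα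
    have hc : edgeClass (γ + α) = edgeClass (γ + β) := by
      rw [edgeClass_add, edgeClass_add, h]
    obtain ⟨hsf, hmin⟩ := isMinJoin_of_edgeClass_eq hα.1 hα.2.isMinJoin hc
    refine ⟨hsf, hα.2.step hmin ?_⟩
    obtain ⟨e, he⟩ := Finsupp.ne_iff.1 hγ
    have h1 := hα.1 e
    have h2 := hsf e
    refine ⟨e, Finset.mem_inter.2 ⟨mem_oddSupport.2 ?_, mem_oddSupport.2 ?_⟩⟩ <;>
    · rw [Finsupp.add_apply] at *
      rw [Finsupp.zero_apply] at he
      rw [Nat.odd_iff]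
      omega
  have hzero : ∀ g ∈ lowIdeal (eulerianIdeal K G) J.card, ψ g = 0 := by
    refine fun g hg => map_eq_zero_of_mem_span ψ ?_ hg
    rintro g ⟨hgI, d, hd, hgd⟩ γ
    by_cases hγ : γ = 0
    · subst hγ
      change ψ (1 * g) = 0
      rw [one_mul, g.as_sum, map_sum]
      refine Finset.sum_eq_zero fun α hα => ?_
      have hα' : α ∉ A := fun h => by
        have h1 := hdeg α h
        have h2 : d = α.degree := hgd.degree_eq_sum_deg_support hα
        omega
      rw [← mul_one (coeff α g), ← smul_eq_mul, ← smul_monomial, map_smul, hψ, if_neg hα',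
        smul_zero]
    · rw [mem_eulerianIdeal_iff] at hgI
      let θ : MvPolynomial G.edgeSet K →ₗ[K] K :=
        ψ.comp (LinearMap.mulLeft K (monomial γ 1))
      have hθ : ∀ α, θ (monomial α 1) = if γ + α ∈ A then 1 else 0 := fun α => by
        simp only [θ, LinearMap.comp_apply, LinearMap.mulLeft_apply, monomial_mul, mul_one, hψ]
      change θ g = 0
      by_cases hex : ∃ α, γ + α ∈ A
      · obtain ⟨α, hα⟩ := hex
        have : θ = (Finsupp.lapply (edgeClass α)).comp (classMap edgeClass) := by
          refine linearMap_ext_monomial fun β => ?_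
          rw [hθ, LinearMap.comp_apply, classMap_monomial, Finsupp.lapply_apply,
            Finsupp.single_apply]
          by_cases hβ : edgeClass β = edgeClass α
          · rw [if_pos hβ, if_pos (hstep γ α β hγ hβ.symm hα)]
          · rw [if_neg hβ, if_neg]
            intro hβA
            refine hβ (add_left_cancel (a := edgeClass γ) ?_)
            rw [← edgeClass_add, ← edgeClass_add, ← eq_setExp_oddSupport hβA.1,
              ← eq_setExp_oddSupport hα.1]
            exact edgeClass_setExp_eq hβA.2.isMinJoin.1 hα.2.isMinJoin.1
              (hβA.2.isMinJoin.card_eq hα.2.isMinJoin)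
        rw [this, LinearMap.comp_apply, hgI, map_zero]
      · have : θ = 0 := linearMap_ext_monomial fun β => by
          rw [hθ, if_neg fun h => hex ⟨β, h⟩, LinearMap.zero_apply]
        rw [this, LinearMap.zero_apply]
  intro hmem
  have := hzero _ hmem
  rw [map_sub, hψ, hψ, if_pos, if_neg] at this
  · simp at this
  · exact fun h => hJL (oddSupport_setExp L ▸ h.2)
  · refine ⟨fun e => ?_, 0, fun _ => J, rfl, (oddSupport_setExp J).symm, fun _ _ => hJ,
      fun _ h => absurd h (Nat.not_lt_zero _)⟩
    rw [setExp_apply]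
    split_ifs <;> omega

lemma exists_notMem_lowIdeal_two (hE : 2 ≤ G.edgeSet.ncard) :
    ∃ f ∈ eulerianIdeal K G, f.IsHomogeneous 2 ∧ f ∉ lowIdeal (eulerianIdeal K G) 2 := by
  obtain ⟨e, he, f, hf, hef⟩ := Set.one_lt_ncard_iff_nontrivial.1 (by omega : 1 < G.edgeSet.ncard)
  have hne : (⟨e, he⟩ : G.edgeSet) ≠ ⟨f, hf⟩ := fun h => hef (congrArg Subtype.val h)
  generalize (⟨e, he⟩ : G.edgeSet) = a at hne
  generalize (⟨f, hf⟩ : G.edgeSet) = b at hne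
  refine ⟨monomial (Finsupp.single a 2) 1 - monomial (Finsupp.single b 2) 1,
    monomial_sub_monomial_mem_eulerianIdeal (by rw [edgeClass_single_two, edgeClass_single_two]),
    (isHomogeneous_monomial _ (Finsupp.degree_single _ _)).sub
      (isHomogeneous_monomial _ (Finsupp.degree_single _ _)), ?_⟩
  have hbot : lowIdeal (eulerianIdeal K G) 2 = ⊥ := by
    refine (Ideal.span_eq_bot).2 ?_
    rintro g ⟨hgI, d, hd, hgd⟩
    rw [← Ideal.mem_bot]
    refine mem_of_classMap_eq_zero edgeClass ⊥ ((mem_eulerianIdeal_iff g).1 hgI) ?_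
    intro α hα β hβ
    have hαd : d = α.degree := hgd.degree_eq_sum_deg_support hα
    rw [eq_of_edgeClass_eq_of_degree_le_one hβ.symm (by omega), sub_self]
    exact zero_mem _
  rw [hbot, Ideal.mem_bot, sub_eq_zero]
  intro h
  have := monomial_left_injective (one_ne_zero (α := K)) h
  rw [Finsupp.single_left_inj two_ne_zero] at this
  exact hne this

lemma exists_tgstar_of_notMem_lowIdeal {d : ℕ} (hd : d ≠ 2) {f : MvPolynomial G.edgeSet K}
    (hf : f ∈ eulerianIdeal K G) (hfd : f.IsHomogeneous d)
    (hlow : f ∉ lowIdeal (eulerianIdeal K G) d) :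
    ∃ (T : Finset (Fin n)) (p : ZMod 2) (J : Finset G.edgeSet),
      TGstar G T p ∧ IsMinJoin G T p J ∧ d = J.card := by
  classical
  obtain ⟨α, hα, β, hβ, hαβ⟩ : ∃ α ∈ f.support, ∃ β, edgeClass β = edgeClass α ∧
      monomial α (1 : K) - monomial β 1 ∉ lowIdeal (eulerianIdeal K G) d := by
    by_contra! hcon
    exact hlow (mem_of_classMap_eq_zero edgeClass _ ((mem_eulerianIdeal_iff f).1 hf) hcon)
  obtain rfl : d = α.degree := hfd.degree_eq_sum_deg_support hα
  have hd3 : 3 ≤ α.degree := by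
    by_contra hlt
    refine hαβ ?_
    rw [eq_of_edgeClass_eq_of_degree_le_one hβ.symm (by omega), sub_self]
    exact zero_mem _
  have hsf : ∀ γ : G.edgeSet →₀ ℕ, edgeClass α = edgeClass γ → ∀ e, γ e ≤ 1 := by
    intro γ hγ e
    by_contra he
    have h1 := monomial_sub_monomial_mem_lowIdeal_of_not_squarefree (K := K) hγ hd3 (e := e)
      (by omega)
    have h2 := monomial_sub_monomial_mem_lowIdeal_of_not_squarefree (K := K) (hβ.trans hγ)
      ((edgeClass_eq_iff.1 hβ).1 ▸ hd3) (e := e) (by omega)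
    rw [(edgeClass_eq_iff.1 hβ).1] at h2
    have := sub_mem h1 h2
    rw [sub_sub_sub_cancel_right] at this
    exact hαβ this
  have hαsf := hsf α rfl
  have hβsf := hsf β hβ.symm
  have hαcard := (degree_eq_card_iff α).2 hαsf
  let T : Finset (Fin n) := Finset.univ.filter fun i => Odd (degIn G (oddSupport α) i)
  have hT : IsTPJoin G T ((oddSupport α).card : ZMod 2) (oddSupport α) :=
    ⟨fun i => by simp [T], rfl⟩
  have hmin : IsMinJoin G T ((oddSupport α).card : ZMod 2) (oddSupport α) := by
    refine ⟨hT, fun J hJ => ?_⟩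
    by_contra! hlt
    obtain ⟨e, -⟩ : (oddSupport α).Nonempty := Finset.card_pos.1 (by omega)
    have hpar := (ZMod.natCast_eq_natCast_iff' _ _ 2).1 hJ.2
    obtain ⟨k, hk⟩ : ∃ k, (oddSupport α).card = J.card + 2 * k :=
      ⟨((oddSupport α).card - J.card) / 2, by omega⟩
    have hodd : oddSupport (setExp J + Finsupp.single e (2 * k)) = J := by
      ext f
      rw [mem_oddSupport, Finsupp.add_apply, setExp_apply, Finsupp.single_apply, Nat.odd_iff]
      split_ifs with h1 h2 h2 <;> simp only [h1, iff_true, iff_false] <;> omega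
    have hc : edgeClass α = edgeClass (setExp J + Finsupp.single e (2 * k)) := by
      rw [edgeClass_eq_iff, hodd, map_add, degree_setExp, Finsupp.degree_single]
      exact ⟨by omega, fun i => (hT.1 i).symm.trans (hJ.1 i)⟩
    have := hsf _ hc e
    rw [Finsupp.add_apply, Finsupp.single_eq_same] at this
    omega
  refine ⟨T, _, oddSupport α, ⟨oddSupport α, oddSupport β, hmin,
    (isMinJoin_of_edgeClass_eq hαsf hmin hβ.symm).2, fun heq => hαβ ?_⟩, hmin, hαcard⟩
  have := heq.monomial_sub_mem_lowIdeal (K := K)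
  rwa [eq_setExp_oddSupport hαsf, eq_setExp_oddSupport hβsf, ← hαcard] at this

end ParityClasses

/-- the degrees of the elements of a minimal homogeneous generating set of
`I(G)` are exactly `2` together with the cardinalities of the minimum cardinality
`(T,p)`-joins for `(T,p) ∈ 𝒯_G*`. -/
theorem stmt6 {n : ℕ} (K : Type*) [Field K] (G : SimpleGraph (Fin n))
    (hE : 2 ≤ G.edgeSet.ncard) (S : Set (MvPolynomial G.edgeSet K))
    (hS : IsMinimalHomGenSet S (eulerianIdeal K G)) :
    (fun f : MvPolynomial G.edgeSet K => f.totalDegree) '' S =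
      {2} ∪ {c : ℕ | ∃ (T : Finset (Fin n)) (p : ZMod 2) (J : Finset G.edgeSet),
        TGstar G T p ∧ IsMinJoin G T p J ∧ c = J.card} := by
  ext d
  rw [mem_totalDegree_image_iff hS]
  constructor
  · rintro ⟨f, hf, hfd, hlow⟩
    by_cases hd : d = 2
    · exact Or.inl hd
    · exact Or.inr (exists_tgstar_of_notMem_lowIdeal hd hf hfd hlow)
  · rintro (rfl | ⟨T, p, J, ⟨L, M, hL, hM, hLM⟩, hJ, rfl⟩)
    · exact exists_notMem_lowIdeal_two hE
    · rw [hJ.card_eq hL]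
      exact ⟨_, monomial_sub_monomial_mem_eulerianIdeal
          (edgeClass_setExp_eq hL.1 hM.1 (hL.card_eq hM)),
        (isHomogeneous_monomial _ (degree_setExp L)).sub
          (isHomogeneous_monomial _ ((degree_setExp M).trans (hM.card_eq hL))),
        monomial_sub_monomial_notMem_lowIdeal hL hLM⟩
end

section
/- Let (T,p) ∈ 𝒯_G* and let J and K be nonequivalent minimum cardinality (T,p)-joins. Then J and K are disjoint, and J ∪ K is either an even cycle of G, or the edge-disjoint union of two odd cycles of G having at most one vertex in common. -/
open MvPolynomial Finset

variable {n : ℕ}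

section DegIn

variable (G : SimpleGraph (Fin n))

theorem degIn_union_of_disjoint {A B : Finset G.edgeSet} (h : Disjoint A B) (i : Fin n) :
    degIn G (A ∪ B) i = degIn G A i + degIn G B i := by
  unfold degIn
  rw [filter_union, card_union_of_disjoint (disjoint_filter_filter h)]

theorem degIn_sdiff_add {A C : Finset G.edgeSet} (h : A ⊆ C) (i : Fin n) :
    degIn G (C \ A) i + degIn G A i = degIn G C i := by
  rw [← degIn_union_of_disjoint G sdiff_disjoint, sdiff_union_of_subset h]

variable {G}

theorem IsEulerianSet.union {A B : Finset G.edgeSet} (hA : IsEulerianSet G A)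
    (hB : IsEulerianSet G B) (h : Disjoint A B) : IsEulerianSet G (A ∪ B) := fun i => by
  rw [degIn_union_of_disjoint G h]
  exact (hA i).add (hB i)

theorem IsEulerianSet.sdiff {A C : Finset G.edgeSet} (hC : IsEulerianSet G C)
    (hA : IsEulerianSet G A) (h : A ⊆ C) : IsEulerianSet G (C \ A) := fun i => by
  have := degIn_sdiff_add G h i
  have := hC i
  have := hA i
  grind

theorem IsTJoin.union_isEulerianSet {T : Finset (Fin n)} {A B : Finset G.edgeSet}
    (hA : IsTJoin G T A) (hB : IsTJoin G T B) (h : Disjoint A B) :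
    IsEulerianSet G (A ∪ B) := fun i => by
  rw [degIn_union_of_disjoint G h, Nat.even_add', ← hA i, ← hB i]

/-- The symmetric difference of a `T`-join and an Eulerian set is a `T`-join. -/
theorem IsTJoin.exchange {T : Finset (Fin n)} {J A : Finset G.edgeSet} (hJ : IsTJoin G T J)
    (hA : IsEulerianSet G A) : IsTJoin G T ((J \ A) ∪ (A \ J)) := fun i => by
  have h1 := degIn_union_of_disjoint G (A := J \ A) (B := A \ J)
    (disjoint_left.2 fun x hx hx' => by grind) i
  have h2 := degIn_sdiff_add G (A := J ∩ A) (C := J) inter_subset_left i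
  have h3 := degIn_sdiff_add G (A := J ∩ A) (C := A) inter_subset_right i
  rw [sdiff_inter_self_left] at h2
  rw [sdiff_inter_self_right] at h3
  have := hA i
  rw [hJ i]
  grind

theorem IsTPJoin.exchange {T : Finset (Fin n)} {p : ZMod 2} {J A : Finset G.edgeSet}
    (hJ : IsTPJoin G T p J) (hA : IsEulerianSet G A) (hc : Even A.card) :
    IsTPJoin G T p ((J \ A) ∪ (A \ J)) := by
  refine ⟨hJ.1.exchange hA, ?_⟩
  rw [← hJ.2, ZMod.natCast_eq_natCast_iff,
    card_union_of_disjoint (disjoint_left.2 fun x hx hx' => by grind)]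
  have h2 := card_sdiff_add_card_inter J A
  have h3 := card_sdiff_add_card_inter A J
  rw [inter_comm] at h3
  obtain ⟨k, hk⟩ := hc
  unfold Nat.ModEq
  omega

/-- The degrees in the edge set of a trail are the incidence counts of the trail. -/
theorem degIn_eq_countP {u v : Fin n} {w : G.Walk u v} (hw : w.IsTrail) {C : Finset G.edgeSet}
    (hC : C.image (fun e => e.val) = w.edges.toFinset) (i : Fin n) :
    degIn G C i = w.edges.countP (fun e => i ∈ e) := by
  have h : degIn G C i = ((C.image (fun e => e.val)).filter (fun e => i ∈ e)).card := by
    rw [filter_image, card_image_of_injective _ Subtype.val_injective]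
    rfl
  rw [h, hC, List.countP_eq_length_filter, ← List.toFinset_card_of_nodup
    (hw.edges_nodup.filter _), List.toFinset_filter]
  simp

theorem IsCycleSet.isEulerianSet {C : Finset G.edgeSet} (hC : IsCycleSet G C) :
    IsEulerianSet G C := fun i => by
  obtain ⟨v, w, hw, h⟩ := hC
  rw [degIn_eq_countP hw.isTrail h, hw.isTrail.even_countP_edges_iff]
  simp

theorem IsCycleSet.nonempty {C : Finset G.edgeSet} (hC : IsCycleSet G C) : C.Nonempty := by
  obtain ⟨v, w, hw, h⟩ := hC
  have : w.edges ≠ [] := by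
    have := hw.three_le_length
    rw [← List.length_pos_iff, SimpleGraph.Walk.length_edges]
    omega
  rw [← image_nonempty (f := fun e : G.edgeSet => e.val), h]
  simpa using this

theorem image_filter_mem_edges {u v : Fin n} (w : G.Walk u v) {C : Finset G.edgeSet}
    (hC : ∀ e ∈ w.edges, ∃ h : e ∈ G.edgeSet, ⟨e, h⟩ ∈ C) :
    (C.filter fun e => e.val ∈ w.edges).image (fun e => e.val) = w.edges.toFinset := by
  ext e
  simp only [mem_image, mem_filter, List.mem_toFinset]
  constructor
  · rintro ⟨a, ⟨-, ha⟩, rfl⟩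
    exact ha
  · intro he
    obtain ⟨h, h'⟩ := hC e he
    exact ⟨⟨e, h⟩, ⟨h', he⟩, rfl⟩

/-- Two vertices of a cycle are joined by a path inside the cycle. -/
theorem IsCycleSet.exists_join {C : Finset G.edgeSet} (hC : IsCycleSet G C) {u v : Fin n}
    (huv : u ≠ v) (hu : u ∈ edgeVerts G C) (hv : v ∈ edgeVerts G C) :
    ∃ P ⊆ C, ∀ i, Even (degIn G P i) ↔ i ≠ u ∧ i ≠ v := by
  obtain ⟨a, w, hw, h⟩ := hC
  have hsupp : ∀ x ∈ edgeVerts G C, x ∈ w.support := by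
    intro x hx
    obtain ⟨e, he, hxe⟩ := (mem_filter.1 hx).2
    have he' : e.val ∈ w.edges := by
      rw [← List.mem_toFinset, ← h]
      exact mem_image_of_mem _ he
    exact w.mem_support_of_mem_edges he' hxe
  have hu' := hsupp u hu
  have hmem : ∀ e, e ∈ (w.rotate u hu').edges ↔ e ∈ w.edges := fun e =>
    (w.rotate_edges u hu').mem_iff
  have hv' : v ∈ (w.rotate u hu').support := by
    obtain ⟨e, he, hve⟩ := (mem_filter.1 hv).2
    have he' : e.val ∈ w.edges := by
      rw [← List.mem_toFinset, ← h]
      exact mem_image_of_mem _ he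
    exact (w.rotate u hu').mem_support_of_mem_edges ((hmem _).2 he') hve
  let q := (w.rotate u hu').takeUntil v hv'
  have hq : q.IsTrail := (hw.isTrail.rotate hu').takeUntil hv'
  have hqw : ∀ e ∈ q.edges, ∃ h : e ∈ G.edgeSet, ⟨e, h⟩ ∈ C := by
    intro e he
    have he' : e ∈ w.edges :=
      (hmem e).1 (SimpleGraph.Walk.edges_takeUntil_subset_edges _ hv' he)
    rw [← List.mem_toFinset, ← h] at he'
    obtain ⟨⟨a, ha⟩, ha', rfl⟩ := mem_image.1 he'
    exact ⟨ha, ha'⟩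
  refine ⟨C.filter fun e => e.val ∈ q.edges, filter_subset _ _, fun i => ?_⟩
  rw [degIn_eq_countP hq (image_filter_mem_edges q hqw), hq.even_countP_edges_iff]
  simp [huv]

/-- A nonempty Eulerian set contains a cycle. -/
theorem IsEulerianSet.exists_isCycleSet {C : Finset G.edgeSet} (hC : IsEulerianSet G C)
    (hne : C.Nonempty) : ∃ D ⊆ C, IsCycleSet G D := by
  let H : SimpleGraph (Fin n) := SimpleGraph.fromEdgeSet (Subtype.val '' (C : Set G.edgeSet))
  have hadj : ∀ {a b}, H.Adj a b ↔ ∃ h : G.Adj a b, (⟨s(a, b), h⟩ : G.edgeSet) ∈ C := by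
    intro a b
    simp only [H, SimpleGraph.fromEdgeSet_adj, Set.mem_image, mem_coe, Subtype.exists,
      exists_and_right, exists_eq_right, SimpleGraph.mem_edgeSet]
    exact ⟨fun h => h.1, fun h => ⟨h, h.1.ne⟩⟩
  have hle : H ≤ G := fun a b h => (hadj.1 h).1
  by_cases hac : H.IsAcyclic
  · exfalso
    obtain ⟨⟨e, he⟩, heC⟩ := hne
    induction e with | _ a b
    have hab : H.Adj a b := hadj.2 ⟨he, heC⟩
    have : Nonempty (Fin n) := ⟨a⟩
    obtain ⟨u, v, p, hp, hmax⟩ :=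
      SimpleGraph.Walk.exists_isPath_forall_isPath_length_le_length H
    have hnil : ¬ p.Nil := by
      have h1 := hmax a b hab.toWalk (SimpleGraph.Walk.IsPath.of_adj hab)
      rw [SimpleGraph.Walk.length_cons, SimpleGraph.Walk.length_nil] at h1
      rw [← SimpleGraph.Walk.length_eq_zero_iff]
      omega
    have hus := p.adj_snd hnil
    have huniq : ∀ x, H.Adj u x → x = p.snd := by
      intro x hx
      apply hac.eq_snd_of_adj_start hp hx
      have : ¬ (p.cons hx.symm).IsPath := by grind [SimpleGraph.Walk.length_cons]
      grind [hp.cons]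
    obtain ⟨hG, hsC⟩ := hadj.1 hus
    have hone : degIn G C u = 1 := by
      refine card_eq_one.2 ⟨⟨s(u, p.snd), hG⟩, ?_⟩
      ext ⟨e, he⟩
      simp only [mem_filter, mem_singleton]
      constructor
      · rintro ⟨heC, hue⟩
        obtain ⟨x, rfl⟩ := hue
        exact Subtype.ext (congrArg (s(u, ·)) (huniq x (hadj.2 ⟨he, heC⟩)))
      · intro h
        obtain rfl : e = s(u, p.snd) := congrArg Subtype.val h
        exact ⟨hsC, Sym2.mem_mk_left _ _⟩
    have := hC u
    rw [hone] at this
    exact Nat.not_even_one this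
  · simp only [SimpleGraph.IsAcyclic, not_forall, not_not] at hac
    obtain ⟨v, w, hw⟩ := hac
    refine ⟨C.filter fun e => e.val ∈ (w.mapLe hle).edges, filter_subset _ _, v, w.mapLe hle,
      hw.mapLe hle, image_filter_mem_edges _ fun e he => ?_⟩
    rw [SimpleGraph.Walk.edges_mapLe_eq_edges] at he
    have := w.edges_subset_edgeSet he
    induction e with | _ a b
    exact hadj.1 this

/-- A nonempty even Eulerian set that is not the disjoint union of two nonempty even Eulerian sets
is an even cycle or the union of two odd cycles sharing no edge and at most one vertex. -/
theorem IsEulerianSet.isCycleSet_or_of_indecomposable {C : Finset G.edgeSet}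
    (hC : IsEulerianSet G C) (hc : Even C.card) (hne : C.Nonempty)
    (hind : ∀ A ⊆ C, IsEulerianSet G A → Even A.card → A.Nonempty → A = C) :
    (IsCycleSet G C ∧ Even C.card) ∨
      ∃ C₁ C₂ : Finset G.edgeSet,
        IsCycleSet G C₁ ∧ Odd C₁.card ∧ IsCycleSet G C₂ ∧ Odd C₂.card ∧
        Disjoint C₁ C₂ ∧ C = C₁ ∪ C₂ ∧ (edgeVerts G C₁ ∩ edgeVerts G C₂).card ≤ 1 := by
  obtain ⟨C₁, h₁C, h₁⟩ := hC.exists_isCycleSet hne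
  rcases Nat.even_or_odd C₁.card with ho₁ | ho₁
  · rw [hind C₁ h₁C h₁.isEulerianSet ho₁ h₁.nonempty] at h₁
    exact .inl ⟨h₁, hc⟩
  have hs := card_sdiff_add_card_eq_card h₁C
  obtain ⟨C₂, h₂C, h₂⟩ := (hC.sdiff h₁.isEulerianSet h₁C).exists_isCycleSet
    (card_pos.1 (by grind))
  have hdisj : Disjoint C₁ C₂ := disjoint_of_subset_right h₂C disjoint_sdiff
  have h₂C' := h₂C.trans sdiff_subset
  rcases Nat.even_or_odd C₂.card with ho₂ | ho₂
  · have heq := hind C₂ h₂C' h₂.isEulerianSet ho₂ h₂.nonempty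
    exact .inl ⟨heq ▸ h₂, hc⟩
  have hU : C₁ ∪ C₂ = C := hind _ (union_subset h₁C h₂C') (h₁.isEulerianSet.union h₂.isEulerianSet
    hdisj) (by rw [card_union_of_disjoint hdisj]; exact ho₁.add_odd ho₂)
    (h₁.nonempty.mono subset_union_left)
  refine .inr ⟨C₁, C₂, h₁, ho₁, h₂, ho₂, hdisj, hU.symm, ?_⟩
  by_contra! hcard
  obtain ⟨u, hu, v, hv, huv⟩ := one_lt_card.1 hcard
  rw [mem_inter] at hu hv
  obtain ⟨P, hP, hPd⟩ := h₁.exists_join huv hu.1 hv.1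
  obtain ⟨Q, hQ, hQd, hpar⟩ : ∃ Q ⊆ C₂, (∀ i, Even (degIn G Q i) ↔ i ≠ u ∧ i ≠ v) ∧
      Even (P.card + Q.card) := by
    obtain ⟨Q, hQ, hQd⟩ := h₂.exists_join huv hu.2 hv.2
    by_cases hpar : Even (P.card + Q.card)
    · exact ⟨Q, hQ, hQd, hpar⟩
    · refine ⟨C₂ \ Q, sdiff_subset, fun i => ?_, ?_⟩
      · have := degIn_sdiff_add G hQ i
        have := h₂.isEulerianSet i
        rw [← hQd i]
        grind
      · have := card_sdiff_add_card_eq_card hQ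
        grind
  have hPQ : Disjoint P Q := disjoint_of_subset_left hP (disjoint_of_subset_right hQ hdisj)
  have hPne : P.Nonempty := by
    rw [nonempty_iff_ne_empty]
    rintro rfl
    exact ((hPd u).1 (by simp [degIn])).1 rfl
  have heq := hind (P ∪ Q) (union_subset (hP.trans h₁C) (hQ.trans h₂C'))
    (fun i => by rw [degIn_union_of_disjoint G hPQ, Nat.even_add, hPd, hQd])
    (by rwa [card_union_of_disjoint hPQ]) (hPne.mono subset_union_left)
  have hPC : P = C₁ := by
    refine hP.antisymm fun e he => ?_
    have : e ∈ P ∪ Q := heq ▸ h₁C he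
    exact (mem_union.1 this).resolve_right fun h => disjoint_left.1 hdisj he (hQ h)
  rw [hPC] at hPd
  exact ((hPd u).1 (h₁.isEulerianSet u)).1 rfl

theorem JoinEquiv.refl {T : Finset (Fin n)} {p : ZMod 2} {J : Finset G.edgeSet}
    (hJ : IsMinJoin G T p J) : JoinEquiv G T p J J :=
  ⟨0, fun _ => J, rfl, rfl, fun _ _ => hJ, fun _ h => absurd h (Nat.not_lt_zero _)⟩

theorem JoinEquiv.of_inter_inter {T : Finset (Fin n)} {p : ZMod 2} {J L K : Finset G.edgeSet}
    (hJ : IsMinJoin G T p J) (hL : IsMinJoin G T p L) (hK : IsMinJoin G T p K)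
    (hJL : (J ∩ L).Nonempty) (hLK : (L ∩ K).Nonempty) : JoinEquiv G T p J K := by
  refine ⟨2, fun i => if i = 0 then J else if i = 1 then L else K, rfl, rfl, fun i _ => ?_,
    fun i hi => ?_⟩
  · dsimp only
    split_ifs <;> assumption
  · interval_cases i <;> simpa

end DegIn

/-- if `J` and `K` are nonequivalent minimum cardinality `(T,p)`-joins, then
they are disjoint and `J ∪ K` is either an even cycle, or the edge-disjoint union of two
odd cycles having at most one vertex in common. -/
theorem stmt7 {n : ℕ} (G : SimpleGraph (Fin n)) (hE : 2 ≤ G.edgeSet.ncard)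
    (T : Finset (Fin n)) (p : ZMod 2) (hTp : TGstar G T p)
    (J K' : Finset G.edgeSet) (hJ : IsMinJoin G T p J) (hK : IsMinJoin G T p K')
    (hne : ¬ JoinEquiv G T p J K') :
    Disjoint J K' ∧
      ((IsCycleSet G (J ∪ K') ∧ Even (J ∪ K').card) ∨
        ∃ C₁ C₂ : Finset G.edgeSet,
          IsCycleSet G C₁ ∧ Odd C₁.card ∧ IsCycleSet G C₂ ∧ Odd C₂.card ∧
          Disjoint C₁ C₂ ∧ J ∪ K' = C₁ ∪ C₂ ∧
          (edgeVerts G C₁ ∩ edgeVerts G C₂).card ≤ 1) := by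
  have hcard : J.card = K'.card := le_antisymm (hJ.2 _ hK.1) (hK.2 _ hJ.1)
  have hdisj : Disjoint J K' := by
    by_contra h
    have h' : (J ∩ K').Nonempty := not_disjoint_iff_nonempty_inter.1 h
    exact hne (.of_inter_inter hJ hJ hK (by simpa using h'.mono inter_subset_left) h')
  refine ⟨hdisj, ?_⟩
  have hUcard := card_union_of_disjoint hdisj
  refine (hJ.1.1.union_isEulerianSet hK.1.1 hdisj).isCycleSet_or_of_indecomposable
    (by rw [hUcard, hcard]; exact ⟨_, rfl⟩) ?_ ?_
  · rw [nonempty_iff_ne_empty]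
    intro h
    rw [union_eq_empty] at h
    obtain ⟨rfl, rfl⟩ := h
    exact hne (.refl hJ)
  intro A hA hAe hAc hAne
  have hL := hJ.1.exchange hAe hAc
  have hM := hK.1.exchange hAe hAc
  have h1 := hJ.2 _ hL
  have h2 := hK.2 _ hM
  rw [card_union_of_disjoint (disjoint_left.2 fun x hx hx' => by grind)] at h1 h2
  have hJA := card_sdiff_add_card_inter J A
  have hKA := card_sdiff_add_card_inter K' A
  have hAJ : A \ J = K' ∩ A := by grind [disjoint_left]
  have hAK : A \ K' = J ∩ A := by grind [disjoint_left]
  rw [hAJ] at h1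
  rw [hAK] at h2
  have hAsum := card_sdiff_add_card_inter A J
  rw [hAJ, inter_comm A J] at hAsum
  have hApos := card_pos.2 hAne
  by_contra hAC
  have hlt := card_lt_card (hA.ssubset_of_ne hAC)
  have hLmin : IsMinJoin G T p ((J \ A) ∪ (A \ J)) := by
    refine ⟨hL, fun J' hJ' => le_trans ?_ (hJ.2 J' hJ')⟩
    rw [card_union_of_disjoint (disjoint_left.2 fun x hx hx' => by grind), hAJ]
    omega
  refine hne (.of_inter_inter hJ hLmin hK ?_ ?_)
  · have : (J \ A).Nonempty := card_pos.1 (by omega)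
    exact this.mono (by grind)
  · have : (K' ∩ A).Nonempty := card_pos.1 (by omega)
    exact this.mono (by grind)
end
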